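/- Let k ≥ 2 and let (i_1, i_2, …, i_k) be a reduced word (for the permutation it represents). Set σ' = s_{i_2}·⋯·s_{i_k} and σ = s_{i_1} · σ'. Then the Bruhat interval below σ decomposes as {τ : τ ≤ σ} = {γ : γ ≤ σ' and l(s_{i_1}·γ) = l(γ) + 1} ∪ {s_{i_1}·γ : γ ≤ σ' and l(s_{i_1}·γ) = l(γ) + 1}. -/

import Mathlib

open MvPolynomial

noncomputable section

/-- Valid indices: `i` with `i + 1 < n`. -/
abbrev Idx (n : ℕ) := {i : ℕ // i + 1 < n}

/-- The element `i` of `Fin n`. -/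
def idxLow {n : ℕ} (i : Idx n) : Fin n := ⟨i.1, Nat.lt_of_succ_lt i.2⟩

/-- The element `i + 1` of `Fin n`. -/
def idxHigh {n : ℕ} (i : Idx n) : Fin n := ⟨i.1 + 1, i.2⟩

/-- The simple transposition `s_i = (i, i+1)` in `S_n`. -/
def simpleT {n : ℕ} (i : Idx n) : Equiv.Perm (Fin n) := Equiv.swap (idxLow i) (idxHigh i)

/-- The action of `s_i` on polynomials, renaming the variables `X i` and `X (i+1)`. -/
def sOp {n : ℕ} (i : Idx n) (f : MvPolynomial (Fin n) ℤ) : MvPolynomial (Fin n) ℤ :=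
  rename ⇑(simpleT i) f

/-- The type of families of operators indexed by valid indices. -/
abbrev DD (n : ℕ) := Idx n → MvPolynomial (Fin n) ℤ → MvPolynomial (Fin n) ℤ

/-- `D` is the family of divided difference operators `∂_i`:
`(X i − X (i+1)) * ∂_i f = f − s_i f` (this determines `∂_i f` uniquely since
`MvPolynomial (Fin n) ℤ` is an integral domain). -/
def IsDividedDiff {n : ℕ} (D : DD n) : Prop :=
  ∀ (i : Idx n) (f : MvPolynomial (Fin n) ℤ),
    (X (idxLow i) - X (idxHigh i)) * D i f = f - sOp i f

/-- `π_i f = ∂_i (X i * f)`. -/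
def piOp {n : ℕ} (D : DD n) (i : Idx n) (f : MvPolynomial (Fin n) ℤ) :
    MvPolynomial (Fin n) ℤ :=
  D i (X (idxLow i) * f)

/-- `θ_i f = X (i+1) * ∂_i f`. -/
def thetaOp {n : ℕ} (D : DD n) (i : Idx n) (f : MvPolynomial (Fin n) ℤ) :
    MvPolynomial (Fin n) ℤ :=
  X (idxHigh i) * D i f

/-- `θ_w = θ_{i_1} ∘ ⋯ ∘ θ_{i_k}` for a word `w = (i_1, …, i_k)`. -/
def thetaWord {n : ℕ} (D : DD n) : List (Idx n) → MvPolynomial (Fin n) ℤ → MvPolynomial (Fin n) ℤ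
  | [], f => f
  | i :: w, f => thetaOp D i (thetaWord D w f)

/-- `π_w = π_{i_1} ∘ ⋯ ∘ π_{i_k}` for a word `w = (i_1, …, i_k)`. -/
def piWord {n : ℕ} (D : DD n) : List (Idx n) → MvPolynomial (Fin n) ℤ → MvPolynomial (Fin n) ℤ
  | [], f => f
  | i :: w, f => piOp D i (piWord D w f)

/-- The permutation `s_{i_1} · ⋯ · s_{i_k}` represented by a word. -/
def wordProd {n : ℕ} (w : List (Idx n)) : Equiv.Perm (Fin n) := (w.map simpleT).prod

/-- `w` is a reduced word for `σ`: it represents `σ` and no shorter word does. -/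
def IsReducedWord {n : ℕ} (w : List (Idx n)) (σ : Equiv.Perm (Fin n)) : Prop :=
  wordProd w = σ ∧ ∀ w' : List (Idx n), wordProd w' = σ → w.length ≤ w'.length

/-- The length `l(σ)`: the length of any reduced word for `σ`. -/
def len {n : ℕ} (σ : Equiv.Perm (Fin n)) : ℕ :=
  sInf {k | ∃ w : List (Idx n), wordProd w = σ ∧ w.length = k}

/-- Strong Bruhat order: some reduced word of `γ` is a (not necessarily contiguous)
subword of some reduced word of `σ`. -/
def BruhatLE {n : ℕ} (γ σ : Equiv.Perm (Fin n)) : Prop :=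
  ∃ u v : List (Idx n), IsReducedWord u γ ∧ IsReducedWord v σ ∧ u.Sublist v

/-- The monomial `x^λ = ∏ j, (X j)^(λ j)`. -/
def xpow {n : ℕ} (lam : Fin n → ℕ) : MvPolynomial (Fin n) ℤ := ∏ j, X j ^ lam j

/-- `f` is atom-positive: it lies in the additive submonoid generated by the
Demazure atoms `θ_w (x^λ)` with `w` a reduced word and `λ` a partition. -/
def AtomPos {n : ℕ} (D : DD n) (f : MvPolynomial (Fin n) ℤ) : Prop :=
  f ∈ AddSubmonoid.closure {g : MvPolynomial (Fin n) ℤ |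
    ∃ (w : List (Idx n)) (σ : Equiv.Perm (Fin n)) (lam : Fin n → ℕ),
      IsReducedWord w σ ∧ Antitone lam ∧ g = thetaWord D w (xpow lam)}

/-- `f` is key-positive: it lies in the additive submonoid generated by the
key polynomials `π_w (x^λ)` with `w` a word and `λ` a partition. -/
def KeyPos {n : ℕ} (D : DD n) (f : MvPolynomial (Fin n) ℤ) : Prop :=
  f ∈ AddSubmonoid.closure {g : MvPolynomial (Fin n) ℤ |
    ∃ (w : List (Idx n)) (lam : Fin n → ℕ),
      Antitone lam ∧ g = piWord D w (xpow lam)}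

/-- The number of inversions of a permutation. -/
def invNum {n : ℕ} (σ : Equiv.Perm (Fin n)) : ℕ :=
  (Finset.univ.filter (fun p : Fin n × Fin n => p.1 < p.2 ∧ σ p.2 < σ p.1)).card

end

section BruhatOrder

open Equiv Relation

variable {n : ℕ}

lemma wordProd_nil : wordProd ([] : List (Idx n)) = 1 := rfl

lemma wordProd_cons (i : Idx n) (w : List (Idx n)) :
    wordProd (i :: w) = simpleT i * wordProd w := by
  simp [wordProd]

lemma simpleT_mul_self_mul (i : Idx n) (σ : Perm (Fin n)) :
    simpleT i * (simpleT i * σ) = σ := by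
  simp [simpleT]

lemma simpleT_inv (i : Idx n) : (simpleT i)⁻¹ = simpleT i := swap_inv _ _

lemma idxLow_lt_idxHigh (i : Idx n) : idxLow i < idxHigh i := by
  simp [idxLow, idxHigh, Fin.lt_def]

/-- `i` occurs to the left of `i + 1` in the one-line notation of `σ`. -/
def IsAscent (i : Idx n) (σ : Perm (Fin n)) : Prop :=
  σ⁻¹ (idxLow i) < σ⁻¹ (idxHigh i)

lemma not_isAscent_iff (i : Idx n) (σ : Perm (Fin n)) :
    ¬ IsAscent i σ ↔ σ⁻¹ (idxHigh i) < σ⁻¹ (idxLow i) := by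
  have hne : σ⁻¹ (idxHigh i) ≠ σ⁻¹ (idxLow i) :=
    fun h => (idxLow_lt_idxHigh i).ne' (σ⁻¹.injective h)
  exact not_lt.trans hne.le_iff_lt

lemma isAscent_simpleT_mul_iff (i : Idx n) (σ : Perm (Fin n)) :
    IsAscent i (simpleT i * σ) ↔ ¬ IsAscent i σ := by
  rw [not_isAscent_iff]
  simp [IsAscent, mul_inv_rev, simpleT]

/-- A simple transposition preserves the order of every pair except the one it exchanges. -/
lemma simpleT_lt_simpleT (i : Idx n) {a b : Fin n} (hab : a < b)
    (h : ¬ (a = idxLow i ∧ b = idxHigh i)) : simpleT i a < simpleT i b := by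
  simp only [simpleT, swap_apply_def]
  simp only [Fin.ext_iff, idxLow, idxHigh, Fin.lt_def] at *
  split_ifs <;> grind

lemma simpleT_mul_swap_mul (i : Idx n) (a b : Fin n) (σ : Perm (Fin n)) :
    simpleT i * (swap a b * σ) = swap (simpleT i a) (simpleT i b) * (simpleT i * σ) := by
  rw [swap_apply_apply]
  group

/-- Strong exchange property, for arbitrary (not necessarily reduced) words. -/
lemma exists_eraseIdx_of_inversion (w : List (Idx n)) {a b : Fin n} (hab : a < b)
    (h : (wordProd w)⁻¹ b < (wordProd w)⁻¹ a) :
    ∃ j < w.length, wordProd (w.eraseIdx j) = swap a b * wordProd w := by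
  induction w generalizing a b with
  | nil => exact absurd h (by simpa [wordProd_nil] using hab.le)
  | cons i w ih =>
    by_cases hi : a = idxLow i ∧ b = idxHigh i
    · obtain ⟨rfl, rfl⟩ := hi
      exact ⟨0, by simp, by
        rw [wordProd_cons]
        exact (simpleT_mul_self_mul i _).symm⟩
    · simp only [wordProd_cons, mul_inv_rev, simpleT_inv, Perm.mul_apply] at h
      obtain ⟨j, hj, hw⟩ := ih (simpleT_lt_simpleT i hab hi) h
      refine ⟨j + 1, by simpa using hj, ?_⟩
      rw [List.eraseIdx_cons_succ, wordProd_cons, wordProd_cons, hw, simpleT_mul_swap_mul]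
      simp [simpleT]

lemma exists_wordProd_eq (σ : Perm (Fin n)) : ∃ w : List (Idx n), wordProd w = σ := by
  cases n with
  | zero => exact ⟨[], Subsingleton.elim _ _⟩
  | succ m =>
    have hσ : σ ∈ Submonoid.closure
        (Set.range fun i : Fin m => swap i.castSucc i.succ) := by
      rw [Perm.mclosure_swap_castSucc_succ]
      trivial
    induction hσ using Submonoid.closure_induction_left with
    | one => exact ⟨[], rfl⟩
    | mul_left x hx y _ ih =>
      obtain ⟨i, rfl⟩ := hx
      obtain ⟨w, rfl⟩ := ih
      exact ⟨⟨i, by omega⟩ :: w, wordProd_cons _ _⟩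

lemma len_le_length (w : List (Idx n)) : len (wordProd w) ≤ w.length :=
  Nat.sInf_le ⟨w, rfl, rfl⟩

lemma exists_wordProd_length_eq_len (σ : Perm (Fin n)) :
    ∃ w : List (Idx n), wordProd w = σ ∧ w.length = len σ := by
  obtain ⟨w, hw⟩ := exists_wordProd_eq σ
  exact Nat.sInf_mem (s := {k | ∃ w : List (Idx n), wordProd w = σ ∧ w.length = k})
    ⟨_, w, hw, rfl⟩

lemma isReducedWord_iff (w : List (Idx n)) (σ : Perm (Fin n)) :
    IsReducedWord w σ ↔ wordProd w = σ ∧ w.length = len σ := by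
  constructor
  · rintro ⟨rfl, h⟩
    obtain ⟨w', hw', hl⟩ := exists_wordProd_length_eq_len (wordProd w)
    exact ⟨rfl, (hl ▸ h w' hw').antisymm (len_le_length w)⟩
  · rintro ⟨rfl, h⟩
    exact ⟨rfl, fun w' hw' => h ▸ hw' ▸ len_le_length w'⟩

lemma len_simpleT_mul_le (i : Idx n) (σ : Perm (Fin n)) :
    len (simpleT i * σ) ≤ len σ + 1 := by
  obtain ⟨w, rfl, hw⟩ := exists_wordProd_length_eq_len σ
  rw [← hw, ← wordProd_cons]
  exact len_le_length (i :: w)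

lemma len_simpleT_mul_lt {i : Idx n} {σ : Perm (Fin n)} (h : ¬ IsAscent i σ) :
    len (simpleT i * σ) < len σ := by
  obtain ⟨w, rfl, hw⟩ := exists_wordProd_length_eq_len σ
  obtain ⟨j, hj, he⟩ := exists_eraseIdx_of_inversion w (idxLow_lt_idxHigh i)
    ((not_isAscent_iff _ _).1 h)
  have hle := len_le_length (w.eraseIdx j)
  rw [he, List.length_eraseIdx_of_lt hj] at hle
  exact hle.trans_lt (by omega)

lemma len_simpleT_mul_eq_iff (i : Idx n) (σ : Perm (Fin n)) :
    len (simpleT i * σ) = len σ + 1 ↔ IsAscent i σ := by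
  refine ⟨fun h => ?_, fun h => ?_⟩
  · by_contra hn
    have := len_simpleT_mul_lt hn
    omega
  · have hlt := len_simpleT_mul_lt (i := i) (σ := simpleT i * σ)
      (by rwa [isAscent_simpleT_mul_iff, not_not])
    rw [simpleT_mul_self_mul] at hlt
    have := len_simpleT_mul_le i σ
    omega

lemma isReducedWord_cons_iff (i : Idx n) (w : List (Idx n)) :
    IsReducedWord (i :: w) (wordProd (i :: w)) ↔
      IsReducedWord w (wordProd w) ∧ IsAscent i (wordProd w) := by
  simp only [isReducedWord_iff, true_and, ← len_simpleT_mul_eq_iff, wordProd_cons,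
    List.length_cons]
  have := len_simpleT_mul_le i (wordProd w)
  have := len_le_length w
  omega

/-- Every word has a reduced subword with the same product. -/
lemma exists_reduced_sublist (w : List (Idx n)) :
    ∃ u : List (Idx n), u.Sublist w ∧ IsReducedWord u (wordProd w) := by
  induction w with
  | nil => exact ⟨[], List.Sublist.refl _, rfl, fun _ _ => Nat.zero_le _⟩
  | cons i w ih =>
    obtain ⟨u, hu, hred⟩ := ih
    have hprod := hred.1
    rw [wordProd_cons, ← hprod]
    rw [← hprod] at hred
    by_cases ha : IsAscent i (wordProd u)
    · refine ⟨i :: u, hu.cons_cons i, ?_⟩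
      rw [← wordProd_cons]
      exact (isReducedWord_cons_iff i u).2 ⟨hred, ha⟩
    · obtain ⟨j, hj, he⟩ := exists_eraseIdx_of_inversion u (idxLow_lt_idxHigh i)
        ((not_isAscent_iff _ _).1 ha)
      refine ⟨u.eraseIdx j, ((List.eraseIdx_sublist u j).trans hu).cons i, ?_⟩
      rw [isReducedWord_iff]
      refine ⟨he, ?_⟩
      have hlen := ((isReducedWord_iff _ _).1 hred).2
      have hlt := len_simpleT_mul_lt ha
      have hle := len_simpleT_mul_le i (simpleT i * wordProd u)
      rw [simpleT_mul_self_mul] at hle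
      rw [List.length_eraseIdx_of_lt hj]
      omega

/-- An edge of the Bruhat graph: `σ` is obtained from `γ` by exchanging two values
that occur in increasing order in `γ`. -/
def BruhatStep (γ σ : Perm (Fin n)) : Prop :=
  ∃ a b : Fin n, a < b ∧ γ⁻¹ a < γ⁻¹ b ∧ σ = swap a b * γ

lemma IsAscent.bruhatStep {i : Idx n} {σ : Perm (Fin n)} (h : IsAscent i σ) :
    BruhatStep σ (simpleT i * σ) :=
  ⟨_, _, idxLow_lt_idxHigh i, h, rfl⟩

lemma BruhatStep.simpleT_mul {γ σ : Perm (Fin n)} (h : BruhatStep γ σ) (i : Idx n) :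
    BruhatStep (simpleT i * γ) (simpleT i * σ) ∨ simpleT i * γ = σ := by
  obtain ⟨a, b, hab, hγ, rfl⟩ := h
  by_cases hi : a = idxLow i ∧ b = idxHigh i
  · obtain ⟨rfl, rfl⟩ := hi
    exact Or.inr rfl
  · refine Or.inl ⟨_, _, simpleT_lt_simpleT i hab hi, ?_, simpleT_mul_swap_mul i a b γ⟩
    simpa [mul_inv_rev] using hγ

/-- Lifting property of the Bruhat order. -/
lemma reflTransGen_bruhatStep_simpleT_mul {γ σ : Perm (Fin n)}
    (h : ReflTransGen BruhatStep γ σ) {i : Idx n} (hσ : IsAscent i σ) :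
    ReflTransGen BruhatStep (simpleT i * γ) (simpleT i * σ) := by
  have key : ReflTransGen BruhatStep (simpleT i * γ) (simpleT i * σ) ∨
      ReflTransGen BruhatStep (simpleT i * γ) σ := by
    clear hσ
    induction h with
    | refl => exact Or.inl .refl
    | tail _ hstep ih =>
      rcases ih with ih | ih
      · rcases hstep.simpleT_mul i with hs | hs
        · exact Or.inl (ih.tail hs)
        · exact Or.inr (hs ▸ ih)
      · exact Or.inr (ih.tail hstep)
  exact key.elim id fun h => h.tail hσ.bruhatStep

lemma exists_sublist_of_reflTransGen {γ σ : Perm (Fin n)}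
    (h : ReflTransGen BruhatStep γ σ) (w : List (Idx n)) (hw : wordProd w = σ) :
    ∃ u : List (Idx n), u.Sublist w ∧ wordProd u = γ := by
  induction h using ReflTransGen.head_induction_on with
  | refl => exact ⟨w, List.Sublist.refl _, hw⟩
  | head hstep _ ih =>
    obtain ⟨u, hu, rfl⟩ := ih
    obtain ⟨a, b, hab, hγ, he⟩ := hstep
    obtain ⟨j, -, hj⟩ := exists_eraseIdx_of_inversion u hab
      (by simpa [he, mul_inv_rev] using hγ)
    refine ⟨u.eraseIdx j, (List.eraseIdx_sublist u j).trans hu, ?_⟩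
    rw [hj, he, swap_mul_self_mul]

lemma reflTransGen_of_sublist {u w : List (Idx n)} (h : u.Sublist w)
    (hw : IsReducedWord w (wordProd w)) :
    ReflTransGen BruhatStep (wordProd u) (wordProd w) := by
  induction h with
  | slnil => exact .refl
  | cons i _ ih =>
    obtain ⟨hred, ha⟩ := (isReducedWord_cons_iff _ _).1 hw
    rw [wordProd_cons]
    exact (ih hred).tail ha.bruhatStep
  | cons_cons i _ ih =>
    obtain ⟨hred, ha⟩ := (isReducedWord_cons_iff _ _).1 hw
    rw [wordProd_cons, wordProd_cons]
    exact reflTransGen_bruhatStep_simpleT_mul (ih hred) ha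

/-- The subword and Bruhat graph descriptions of the Bruhat order agree. -/
lemma bruhatLE_iff (γ σ : Perm (Fin n)) : BruhatLE γ σ ↔ ReflTransGen BruhatStep γ σ := by
  constructor
  · rintro ⟨u, v, hu, hv, huv⟩
    obtain rfl := hu.1
    obtain rfl := hv.1
    exact reflTransGen_of_sublist huv hv
  · intro h
    obtain ⟨v, hv⟩ := exists_wordProd_length_eq_len σ
    obtain ⟨w, hw, rfl⟩ := exists_sublist_of_reflTransGen h v hv.1
    obtain ⟨u, hu, hred⟩ := exists_reduced_sublist w
    exact ⟨u, v, hred, (isReducedWord_iff _ _).2 hv, hu.trans hw⟩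

end BruhatOrder

/-- decomposition of the Bruhat interval below `σ = s_{i_1} σ'`. -/
theorem stmt13 (n : ℕ) (hn : 0 < n) (i1 : Idx n) (rest : List (Idx n)) (hrest : rest ≠ [])
    (hred : IsReducedWord (i1 :: rest) (wordProd (i1 :: rest)))
    (τ : Equiv.Perm (Fin n)) :
    BruhatLE τ (simpleT i1 * wordProd rest) ↔
      (BruhatLE τ (wordProd rest) ∧ len (simpleT i1 * τ) = len τ + 1) ∨
      (∃ γ : Equiv.Perm (Fin n), BruhatLE γ (wordProd rest) ∧
        len (simpleT i1 * γ) = len γ + 1 ∧ τ = simpleT i1 * γ) := by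
  obtain ⟨hrestred, ha⟩ := (isReducedWord_cons_iff i1 rest).1 hred
  simp only [bruhatLE_iff, len_simpleT_mul_eq_iff]
  have hstep : ∀ {γ : Equiv.Perm (Fin n)}, ¬ IsAscent i1 γ → BruhatStep (simpleT i1 * γ) γ := by
    intro γ hγ
    have h := ((isAscent_simpleT_mul_iff i1 γ).2 hγ).bruhatStep
    rwa [simpleT_mul_self_mul] at h
  constructor
  · intro h
    obtain ⟨u, hu, rfl⟩ := exists_sublist_of_reflTransGen h (i1 :: rest) (wordProd_cons _ _)
    rcases List.sublist_cons_iff.1 hu with hsub | ⟨u, rfl, hsub⟩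
    · have hle := reflTransGen_of_sublist hsub hrestred
      by_cases hτ : IsAscent i1 (wordProd u)
      · exact Or.inl ⟨hle, hτ⟩
      · exact Or.inr ⟨simpleT i1 * wordProd u, hle.head (hstep hτ),
          (isAscent_simpleT_mul_iff _ _).2 hτ, (simpleT_mul_self_mul _ _).symm⟩
    · have hle := reflTransGen_of_sublist hsub hrestred
      rw [wordProd_cons]
      by_cases hγ : IsAscent i1 (wordProd u)
      · exact Or.inr ⟨wordProd u, hle, hγ, rfl⟩
      · exact Or.inl ⟨hle.head (hstep hγ), (isAscent_simpleT_mul_iff _ _).2 hγ⟩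
  · rintro (⟨h, -⟩ | ⟨γ, h, -, rfl⟩)
    · exact h.tail ha.bruhatStep
    · exact reflTransGen_bruhatStep_simpleT_mul h ha
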